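/- arXiv:2602.09123 — 2 statements merged into one kernel-verified Lean document; each statement's English description precedes it below -/
import Mathlib

section
/- Let M ≥ 1 and N ≥ 1, let d : Fin N → ZMod M → ZMod M → ℝ be additive, and let σ : ZMod M → Fin N be a configuration whose wall set W(σ) = {j ∈ ZMod M : σ (j−1) ≠ σ j} is nonempty. Then the total field energy decomposes into segment contributions between consecutive walls: ∑_{j ∈ ZMod M} d (σ j) j (j+1) = ∑_{p ∈ W(σ)} d (σ p) p (next_{W(σ)} p). -/
/-- The wall set of a spin configuration `σ` on the cycle `ZMod M`:
the set of sites `j` where the spin changes between `j - 1` and `j`. -/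
def wallSet {M N : ℕ} [NeZero M] (σ : ZMod M → Fin N) : Finset (ZMod M) :=
  Finset.univ.filter fun j => σ (j - 1) ≠ σ j

/-- The cyclic successor of `p` within a finset `W ⊆ ZMod M`: `p + k` where
`k` is the least positive natural number with `p + k ∈ W` (such a `k ≤ M`
exists whenever `W` is nonempty; otherwise we return `p` itself). -/
noncomputable def nextWall {M : ℕ} (W : Finset (ZMod M)) (p : ZMod M) : ZMod M :=
  open Classical in
  if h : ∃ k : ℕ, 0 < k ∧ p + (k : ZMod M) ∈ W then p + ((Nat.find h : ℕ) : ZMod M)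
  else p

theorem mem_wallSet {M N : ℕ} [NeZero M] {σ : ZMod M → Fin N} {j : ZMod M} :
    j ∈ wallSet σ ↔ σ (j - 1) ≠ σ j := by
  simp [wallSet]

theorem exists_nextWall_eq_add {M : ℕ} [NeZero M] {W : Finset (ZMod M)} (hW : W.Nonempty)
    (p : ZMod M) :
    ∃ k : ℕ, 0 < k ∧ nextWall W p = p + (k : ZMod M) ∧ p + (k : ZMod M) ∈ W ∧
      ∀ m : ℕ, 0 < m → m < k → p + (m : ZMod M) ∉ W := by
  classical
  have h : ∃ k : ℕ, 0 < k ∧ p + (k : ZMod M) ∈ W := by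
    obtain ⟨w, hw⟩ := hW
    refine ⟨(w - p).val + M, by have := NeZero.pos M; omega, ?_⟩
    simpa using hw
  refine ⟨Nat.find h, (Nat.find_spec h).1, ?_, (Nat.find_spec h).2, fun m hm hmk hmem =>
    Nat.find_min h hmk ⟨hm, hmem⟩⟩
  rw [nextWall, dif_pos h]

theorem nextWall_mem {M : ℕ} [NeZero M] {W : Finset (ZMod M)} (hW : W.Nonempty) (p : ZMod M) :
    nextWall W p ∈ W := by
  obtain ⟨k, -, hk, hmem, -⟩ := exists_nextWall_eq_add hW p
  rwa [hk]

theorem nextWall_injOn {M : ℕ} [NeZero M] {W : Finset (ZMod M)} (hW : W.Nonempty) :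
    Set.InjOn (nextWall W) W := by
  intro p hp q hq hpq
  obtain ⟨k, hk, hpk, -, hkmin⟩ := exists_nextWall_eq_add hW p
  obtain ⟨l, hl, hql, -, hlmin⟩ := exists_nextWall_eq_add hW q
  rw [hpk, hql] at hpq
  rcases lt_trichotomy k l with hkl | rfl | hlk
  · refine absurd ?_ (hlmin (l - k) (by omega) (by omega))
    rw [Nat.cast_sub hkl.le, ← add_sub_assoc, ← hpq, add_sub_cancel_right]
    exact hp
  · exact add_right_cancel hpq
  · refine absurd ?_ (hkmin (k - l) (by omega) (by omega))
    rw [Nat.cast_sub hlk.le, ← add_sub_assoc, hpq, add_sub_cancel_right]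
    exact hq

/-- The spin is constant on the segment from `p` up to the site just before the next wall. -/
theorem apply_nextWall_sub_one {M N : ℕ} [NeZero M] {σ : ZMod M → Fin N}
    (hW : (wallSet σ).Nonempty) (p : ZMod M) :
    σ (nextWall (wallSet σ) p - 1) = σ p := by
  obtain ⟨k, hkpos, hk, -, hmin⟩ := exists_nextWall_eq_add hW p
  have hconst : ∀ m : ℕ, m < k → σ (p + (m : ZMod M)) = σ p := by
    intro m
    induction m with
    | zero => simp
    | succ m ih =>
      intro hm
      have hnot := hmin (m + 1) m.succ_pos hm
      rw [mem_wallSet, not_not] at hnot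
      rw [← hnot, ← ih (by omega)]
      congr 1
      push_cast
      ring
  obtain ⟨m, rfl⟩ := Nat.exists_eq_succ_of_ne_zero hkpos.ne'
  rw [hk, ← hconst m m.lt_succ_self]
  congr 1
  push_cast
  ring

theorem sum_comp_nextWall {M : ℕ} [NeZero M] {W : Finset (ZMod M)} (hW : W.Nonempty)
    (f : ZMod M → ℝ) : ∑ p ∈ W, f (nextWall W p) = ∑ p ∈ W, f p :=
  Finset.sum_nbij (nextWall W) (fun p _ => nextWall_mem hW p) (nextWall_injOn hW)
    (Finset.surjOn_of_injOn_of_card_le _ (fun p _ => nextWall_mem hW p) (nextWall_injOn hW) le_rfl)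
    (fun _ _ => rfl)

/-- For an additive field `d` and a configuration `σ` with a
nonempty wall set, the total field energy decomposes into segment
contributions between consecutive walls. -/
theorem field_energy_segment_decomposition (M N : ℕ) [NeZero M] (hN : 1 ≤ N)
    (d : Fin N → ZMod M → ZMod M → ℝ)
    (hadd : ∀ (i : Fin N) (j l k : ZMod M), d i j l + d i l k = d i j k)
    (σ : ZMod M → Fin N) (hW : (wallSet σ).Nonempty) :
    ∑ j : ZMod M, d (σ j) j (j + 1)
      = ∑ p ∈ wallSet σ, d (σ p) p (nextWall (wallSet σ) p) := by
  have hd : ∀ i j k, d i j k = d i 0 k - d i 0 j := fun i j k =>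
    eq_sub_of_add_eq' (hadd i 0 j k)
  have hshift : ∑ j : ZMod M, d (σ j) 0 (j + 1) = ∑ j : ZMod M, d (σ (j - 1)) 0 j :=
    Fintype.sum_equiv (Equiv.addRight 1) _ _ fun j => by simp
  calc ∑ j : ZMod M, d (σ j) j (j + 1)
      = ∑ j : ZMod M, (d (σ (j - 1)) 0 j - d (σ j) 0 j) := by
        rw [Finset.sum_sub_distrib, ← hshift, ← Finset.sum_sub_distrib]
        exact Finset.sum_congr rfl fun j _ => hd _ _ _
    _ = ∑ p ∈ wallSet σ, (d (σ (p - 1)) 0 p - d (σ p) 0 p) := by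
        refine (Finset.sum_subset (Finset.subset_univ _) fun j _ hj => ?_).symm
        rw [mem_wallSet, not_not] at hj
        rw [hj, sub_self]
    _ = ∑ p ∈ wallSet σ, d (σ p) p (nextWall (wallSet σ) p) := by
        rw [Finset.sum_sub_distrib, ← sum_comp_nextWall hW fun p => d (σ (p - 1)) 0 p,
          ← Finset.sum_sub_distrib]
        refine Finset.sum_congr rfl fun p _ => ?_
        rw [apply_nextWall_sub_one hW, hd _ p]
end

section
/- (Ferromagnetic regime of the Potts model.) Let M ≥ 1, N ≥ 1, and let d : Fin N → ZMod M → ZMod M → ℝ be additive. Suppose λ ∈ ℝ satisfies λ ≥ 0 and 2λ ≥ ∑_{j ∈ ZMod M} max_{i ∈ Fin N} d i j (j+1). Then the spins align in the ground state: for every i₀ ∈ Fin N, the constant configuration σ ≡ i₀ attains the minimum of the Potts energy, i.e., H(σ ≡ i₀) ≤ H(τ) for every configuration τ : ZMod M → Fin N. -/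
/-- The Potts energy of a configuration `σ : ZMod M → Fin N` with onsite
field `d` and nearest-neighbor coupling `lam`:
`H(σ) = -(∑ j, d (σ j) j (j+1)) - lam * #{j : σ j = σ (j+1)}`. -/
def pottsEnergy {M N : ℕ} [NeZero M] (lam : ℝ)
    (d : Fin N → ZMod M → ZMod M → ℝ) (σ : ZMod M → Fin N) : ℝ :=
  -(∑ j : ZMod M, d (σ j) j (j + 1))
    - lam * ((Finset.univ.filter fun j : ZMod M => σ j = σ (j + 1)).card : ℝ)

/-- The domain-wall (Ising) energy of a finset `W ⊆ ZMod M` of wall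
positions, with couplings `J p q = max_i d i p q`:
`E(W) = -(∑ p ∈ W, max_i d i p (next_W p)) - lam * (M - #W)` for nonempty `W`,
and `E(∅) = -lam * M`. -/
noncomputable def isingEnergy {M N : ℕ} [NeZero M] [NeZero N] (lam : ℝ)
    (d : Fin N → ZMod M → ZMod M → ℝ) (W : Finset (ZMod M)) : ℝ :=
  if W.Nonempty then
    -(∑ p ∈ W, Finset.univ.sup' Finset.univ_nonempty
        fun i : Fin N => d i p (nextWall W p))
      - lam * ((M - W.card : ℕ) : ℝ)
  else -lam * (M : ℝ)

/-- An additive field sums to zero around the cycle. -/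
theorem sum_additive_cycle_eq_zero {M : ℕ} [NeZero M] (f : ZMod M → ZMod M → ℝ)
    (hadd : ∀ j l k, f j l + f l k = f j k) : ∑ j : ZMod M, f j (j + 1) = 0 := by
  have hdiff : ∀ j, f j (j + 1) = f 0 (j + 1) - f 0 j := fun j => by
    linarith [hadd 0 j (j + 1)]
  simp_rw [hdiff, Finset.sum_sub_distrib]
  rw [sub_eq_zero]
  exact Equiv.sum_comp (Equiv.addRight (1 : ZMod M)) (f 0)

/-- A configuration on the cycle with at most one domain wall is constant. -/
theorem eq_of_forall_ne_eq_add_one {M : ℕ} [NeZero M] {α : Type*} {τ : ZMod M → α}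
    {a : ZMod M} (h : ∀ j, j ≠ a → τ j = τ (j + 1)) (j : ZMod M) : τ j = τ (a + 1) := by
  have key : ∀ k : ℕ, k < M → τ (a + 1 + k) = τ (a + 1) := by
    intro k
    induction k with
    | zero => simp
    | succ k ih =>
      intro hk
      have hne : a + 1 + (k : ZMod M) ≠ a := by
        intro he
        have hz : ((k + 1 : ℕ) : ZMod M) = 0 := by
          push_cast
          linear_combination he
        rw [ZMod.natCast_eq_zero_iff] at hz
        exact absurd (Nat.le_of_dvd k.succ_pos hz) (not_le.mpr hk)
      rw [← ih (Nat.lt_of_succ_lt hk), h _ hne, Nat.cast_succ, ← add_assoc]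
  simpa using key (j - (a + 1)).val (ZMod.val_lt _)

/-- Ferromagnetic regime of the Potts model: For an additive
field `d`, if `λ ≥ 0` and `2λ ≥ ∑ j, max_i d i j (j+1)`, then every constant
configuration attains the minimum of the Potts energy. -/
theorem potts_ferromagnetic_regime (M N : ℕ) [NeZero M] [NeZero N]
    (lam : ℝ) (hlam : 0 ≤ lam)
    (d : Fin N → ZMod M → ZMod M → ℝ)
    (hadd : ∀ (i : Fin N) (j l k : ZMod M), d i j l + d i l k = d i j k)
    (hbig : ∑ j : ZMod M, Finset.univ.sup' Finset.univ_nonempty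
        (fun i : Fin N => d i j (j + 1)) ≤ 2 * lam) :
    ∀ (i₀ : Fin N) (τ : ZMod M → Fin N),
      pottsEnergy lam d (fun _ => i₀) ≤ pottsEnergy lam d τ := by
  intro i₀ τ
  have hcard := Finset.card_filter_add_card_filter_not (s := (Finset.univ : Finset (ZMod M)))
    (fun j => τ j = τ (j + 1))
  have hcardR := congrArg (Nat.cast : ℕ → ℝ) hcard
  push_cast at hcardR
  set walls := Finset.univ.filter fun j : ZMod M => ¬ τ j = τ (j + 1) with hwalls
  suffices hfield : ∑ j : ZMod M, d (τ j) j (j + 1) ≤ lam * (walls.card : ℝ) by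
    simp only [pottsEnergy, sum_additive_cycle_eq_zero (d i₀) (hadd i₀), Finset.filter_true]
    rw [← hcardR]
    linarith
  rcases Nat.lt_or_ge walls.card 2 with hw | hw
  · obtain ⟨a, ha⟩ := Finset.card_le_one_iff_subset_singleton.mp (Nat.le_of_lt_succ hw)
    have hconst : ∀ j, τ j = τ (a + 1) := eq_of_forall_ne_eq_add_one fun j hj => by
      by_contra hne
      exact hj (Finset.mem_singleton.mp (ha (by simp [hwalls, hne])))
    simp_rw [hconst]
    rw [sum_additive_cycle_eq_zero (d _) (hadd _)]
    positivity
  · have hmax : ∑ j : ZMod M, d (τ j) j (j + 1) ≤ ∑ j : ZMod M,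
        Finset.univ.sup' Finset.univ_nonempty (fun i : Fin N => d i j (j + 1)) :=
      Finset.sum_le_sum fun j _ =>
        Finset.le_sup' (fun i : Fin N => d i j (j + 1)) (Finset.mem_univ (τ j))
    have hwR : (2 : ℝ) ≤ walls.card := by exact_mod_cast hw
    nlinarith [mul_le_mul_of_nonneg_left hwR hlam]
end
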